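/- Define f(m) := ∫₀^{π−α(m)} (1 − 2m sin²θ)(1 − m sin²θ)^{−1/2} dθ for m ∈ [1/2,1), where α(m) := arcsin √(1/(2m)). Then f′(m) < 0 for all m ∈ (1/2,1); moreover f(1/2) > 0 and f(m₈) < 0, where m₈ ∈ (0,1) is the unique zero of m ↦ 2E(m) − K(m). Consequently there exists a unique m_T ∈ (0,1) with f(m_T) = 0, and m_T ∈ (1/2, m₈). -/

import Mathlib

open Real MeasureTheory Set

noncomputable section

/-- Incomplete elliptic integral of the first kind `F(x,m)`. -/
def Fell (x m : ℝ) : ℝ := ∫ θ in (0:ℝ)..x, 1 / Real.sqrt (1 - m * Real.sin θ ^ 2)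

/-- Incomplete elliptic integral of the second kind `E(x,m)`. -/
def Eell (x m : ℝ) : ℝ := ∫ θ in (0:ℝ)..x, Real.sqrt (1 - m * Real.sin θ ^ 2)

/-- Complete elliptic integral of the first kind `K(m)`. -/
def Kc (m : ℝ) : ℝ := Fell (Real.pi / 2) m

/-- Complete elliptic integral of the second kind `E(m)`. -/
def Ec (m : ℝ) : ℝ := Eell (Real.pi / 2) m

/-- `α(m) = arcsin √(1/(2m))`. -/
def alph (m : ℝ) : ℝ := Real.arcsin (Real.sqrt (1 / (2 * m)))

/-- `G(x,m) = ∫₀ˣ (1 − 2m sin²θ)(1 − m sin²θ)^{−1/2} dθ = 2E(x,m) − F(x,m)`. -/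
def Gw (x m : ℝ) : ℝ :=
  ∫ θ in (0:ℝ)..x, (1 - 2 * m * Real.sin θ ^ 2) / Real.sqrt (1 - m * Real.sin θ ^ 2)

/-- `f(m) = ∫₀^{π−α(m)} (1 − 2m sin²θ)(1 − m sin²θ)^{−1/2} dθ`; its unique zero is `m_T`. -/
def fT (m : ℝ) : ℝ := Gw (Real.pi - alph m) m

def gI (m θ : ℝ) : ℝ := (1 - 2 * m * Real.sin θ ^ 2) / Real.sqrt (1 - m * Real.sin θ ^ 2)

lemma den_pos {m : ℝ} (hm : m < 1) (θ : ℝ) : 0 < 1 - m * Real.sin θ ^ 2 := by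
  have h1 := Real.sin_sq_le_one θ
  have h2 := sq_nonneg (Real.sin θ)
  rcases le_total m 0 with h | h
  · nlinarith
  · nlinarith

lemma gI_cont {X : Type*} [TopologicalSpace X] {u v : X → ℝ} (hu : Continuous u)
    (hv : Continuous v) (h : ∀ x, u x < 1) : Continuous fun x => gI (u x) (v x) := by
  unfold gI
  refine Continuous.div (by fun_prop) (by fun_prop) fun x => ?_
  exact (Real.sqrt_pos.2 (den_pos (h x) _)).ne'

lemma gI_cont' {m : ℝ} (hm : m < 1) : Continuous (gI m) :=
  gI_cont continuous_const continuous_id fun _ => hm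

lemma gI_int {m : ℝ} (hm : m < 1) (a b : ℝ) : IntervalIntegrable (gI m) volume a b :=
  (gI_cont' hm).intervalIntegrable a b

lemma two_E_sub_K {m : ℝ} (hm : m < 1) : 2 * Ec m - Kc m = Gw (π / 2) m := by
  have hc : Continuous fun θ : ℝ => Real.sqrt (1 - m * Real.sin θ ^ 2) := by fun_prop
  have hc2 : Continuous fun θ : ℝ => 1 / Real.sqrt (1 - m * Real.sin θ ^ 2) :=
    Continuous.div (by fun_prop) hc fun x => (Real.sqrt_pos.2 (den_pos hm _)).ne'
  unfold Ec Kc Eell Fell Gw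
  rw [← intervalIntegral.integral_const_mul, ← intervalIntegral.integral_sub]
  · congr 1
    ext θ
    have h := Real.sqrt_pos.2 (den_pos hm θ)
    have h2 := Real.sq_sqrt (den_pos hm θ).le
    field_simp
    rw [h2]; ring
  · exact (hc.const_mul 2).intervalIntegrable _ _
  · exact hc2.intervalIntegrable _ _

lemma Gw_pos {m : ℝ} (h0 : 0 < m) (hm : m ≤ 1 / 2) : 0 < Gw (π / 2) m := by
  refine intervalIntegral.intervalIntegral_pos_of_pos_on (gI_int (by linarith) _ _) ?_ (by positivity)
  intro θ hθ
  have hm1 : m < 1 := by linarith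
  refine div_pos ?_ (Real.sqrt_pos.2 (den_pos hm1 θ))
  have hc : 0 < Real.cos θ := Real.cos_pos_of_mem_Ioo ⟨by linarith [hθ.1, Real.pi_pos], hθ.2⟩
  have := Real.sin_sq_add_cos_sq θ
  have : 0 < Real.cos θ ^ 2 := by positivity
  nlinarith

lemma alph_half {m : ℝ} (h0 : 0 < m) (hm : m ≤ 1 / 2) : alph m = π / 2 := by
  unfold alph
  apply Real.arcsin_of_one_le
  rw [Real.one_le_sqrt, le_div_iff₀ (by positivity)]
  linarith

lemma fT_half {m : ℝ} (h0 : 0 < m) (hm : m ≤ 1 / 2) : 0 < fT m := by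
  unfold fT
  rw [alph_half h0 hm, show π - π / 2 = π / 2 by ring]
  exact Gw_pos h0 hm

lemma q_mem {m : ℝ} (hm : 1 / 2 < m) :
    0 < Real.sqrt (1 / (2 * m)) ∧ Real.sqrt (1 / (2 * m)) < 1 := by
  have : 0 < m := by linarith
  refine ⟨Real.sqrt_pos.2 (by positivity), ?_⟩
  rw [Real.sqrt_lt' one_pos, div_lt_iff₀ (by positivity)]
  linarith

lemma sin_alph {m : ℝ} (hm : 1 / 2 < m) : Real.sin (alph m) = Real.sqrt (1 / (2 * m)) :=
  Real.sin_arcsin (by linarith [(q_mem hm).1]) (q_mem hm).2.le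

lemma sin_alph_sq {m : ℝ} (hm : 1 / 2 < m) : 2 * m * Real.sin (alph m) ^ 2 = 1 := by
  have : 0 < m := by linarith
  rw [sin_alph hm, Real.sq_sqrt (by positivity)]
  field_simp

lemma alph_mem {m : ℝ} (hm : 1 / 2 < m) : 0 < alph m ∧ alph m < π / 2 :=
  ⟨Real.arcsin_pos.2 (q_mem hm).1, Real.arcsin_lt_pi_div_two.2 (q_mem hm).2⟩

lemma fT_lt {m : ℝ} (hm : 1 / 2 < m) (h1 : m < 1) : fT m < Gw (π / 2) m := by
  have ha := alph_mem hm
  have h : fT m = Gw (π / 2) m + ∫ θ in (π / 2)..(π - alph m), gI m θ :=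
    (intervalIntegral.integral_add_adjacent_intervals (gI_int h1 _ _) (gI_int h1 _ _)).symm
  have h2 : 0 < ∫ θ in (π / 2)..(π - alph m), - gI m θ := by
    refine intervalIntegral.intervalIntegral_pos_of_pos_on (gI_int h1 _ _).neg ?_ (by linarith)
    intro θ hθ
    rw [neg_pos]
    refine div_neg_of_neg_of_pos ?_ (Real.sqrt_pos.2 (den_pos h1 θ))
    have hs : Real.sin (alph m) < Real.sin θ := by
      rw [← Real.sin_pi_sub θ]
      apply Real.sin_lt_sin_of_lt_of_le_pi_div_two <;> linarith [hθ.1, hθ.2]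
    have hs0 : 0 < Real.sin (alph m) := by rw [sin_alph hm]; exact (q_mem hm).1
    have := sin_alph_sq hm
    have h3 : Real.sin (alph m) ^ 2 < Real.sin θ ^ 2 := by gcongr
    nlinarith
  rw [intervalIntegral.integral_neg] at h2
  linarith

def gD (m θ : ℝ) : ℝ := Real.sin θ ^ 2 * (m * Real.sin θ ^ 2 - 3 / 2) /
  ((1 - m * Real.sin θ ^ 2) * Real.sqrt (1 - m * Real.sin θ ^ 2))

lemma gI_deriv {m : ℝ} (hm : m < 1) (θ : ℝ) : HasDerivAt (fun m => gI m θ) (gD m θ) m := by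
  have hp := den_pos hm θ
  have hs := Real.sqrt_pos.2 hp
  have h2 := Real.sq_sqrt hp.le
  have hd : HasDerivAt (fun m : ℝ => 1 - m * Real.sin θ ^ 2) (- Real.sin θ ^ 2) m := by
    simpa using ((hasDerivAt_id m).mul_const (Real.sin θ ^ 2)).const_sub 1
  have hn : HasDerivAt (fun m : ℝ => 1 - 2 * m * Real.sin θ ^ 2) (- (2 * Real.sin θ ^ 2)) m := by
    simpa using (((hasDerivAt_id m).const_mul 2).mul_const (Real.sin θ ^ 2)).const_sub 1
  have := hn.div (hd.sqrt hp.ne') hs.ne'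
  refine this.congr_deriv ?_
  unfold gD
  rw [h2]
  field_simp
  rw [mul_comm (Real.sin θ ^ 2) m, h2]
  ring

lemma gD_cont {X : Type*} [TopologicalSpace X] {u v : X → ℝ} (hu : Continuous u)
    (hv : Continuous v) (h : ∀ x, u x < 1) : Continuous fun x => gD (u x) (v x) := by
  unfold gD
  refine Continuous.div (by fun_prop) (by fun_prop) fun x => ?_
  have := den_pos (h x) (v x)
  have := (Real.sqrt_pos.2 this)
  positivity

lemma Gw_deriv {m : ℝ} (hm : m ∈ Ioo (1 / 2 : ℝ) 1) (x : ℝ) :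
    HasDerivAt (Gw x) (∫ θ in (0 : ℝ)..x, gD m θ) m := by
  obtain ⟨h0, h1⟩ := hm
  set M := (m + 1) / 2 with hM
  have hM1 : M < 1 := by rw [hM]; linarith
  have hmM : m < M := by rw [hM]; linarith
  have hD := (1 - M)
  have hnb : Ioo (0 : ℝ) M ∈ nhds m := Ioo_mem_nhds (by linarith) hmM
  refine (intervalIntegral.hasDerivAt_integral_of_dominated_loc_of_deriv_le
    (F := gI) (F' := gD) (bound := fun _ => (3 / 2) / ((1 - M) * Real.sqrt (1 - M))) hnb
    ?_ (gI_int h1 _ _) ?_ ?_ ?_ ?_).2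
  · filter_upwards [hnb] with y hy
    exact (gI_cont' (hy.2.trans hM1)).aestronglyMeasurable
  · exact (gD_cont continuous_const continuous_id (fun _ => h1)).aestronglyMeasurable
  · refine Filter.Eventually.of_forall fun θ _ y hy => ?_
    have hs1 := Real.sin_sq_le_one θ
    have hs0 := sq_nonneg (Real.sin θ)
    have hd := den_pos (hy.2.trans hM1) θ
    have hle : 1 - M ≤ 1 - y * Real.sin θ ^ 2 := by nlinarith [hy.1, hy.2]
    have hpM : 0 < 1 - M := by linarith
    have hpM' := Real.sqrt_pos.2 hpM
    have hd' := Real.sqrt_pos.2 hd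
    have hys : 0 ≤ y * Real.sin θ ^ 2 := mul_nonneg hy.1.le hs0
    unfold gD
    rw [Real.norm_eq_abs, abs_div, abs_of_pos (mul_pos hd hd')]
    apply div_le_div₀ (by norm_num) _ (by positivity)
    · exact mul_le_mul hle (Real.sqrt_le_sqrt hle) hpM'.le hd.le
    · rw [abs_mul, abs_of_nonneg hs0]
      have : |y * Real.sin θ ^ 2 - 3 / 2| ≤ 3 / 2 := by rw [abs_le]; constructor <;> linarith
      nlinarith [abs_nonneg (y * Real.sin θ ^ 2 - 3 / 2)]
  · exact intervalIntegrable_const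
  · exact Filter.Eventually.of_forall fun θ _ y hy => gI_deriv (hy.2.trans hM1) θ

lemma alph_diff {m : ℝ} (hm : 1 / 2 < m) : DifferentiableAt ℝ alph m := by
  have hq := q_mem hm
  have hm0 : 0 < m := by linarith
  have h1 : DifferentiableAt ℝ (fun m : ℝ => 1 / (2 * m)) m := by
    refine DifferentiableAt.div (by fun_prop) (by fun_prop) (by positivity)
  have h2 : DifferentiableAt ℝ (fun m : ℝ => Real.sqrt (1 / (2 * m))) m :=
    h1.sqrt (by positivity)
  exact DifferentiableAt.comp m (Real.differentiableAt_arcsin.2 ⟨by linarith, hq.2.ne⟩) h2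

lemma rest_deriv {m : ℝ} (hm : m ∈ Ioo (1 / 2 : ℝ) 1) :
    HasDerivAt (fun y => ∫ θ in (π - alph m)..(π - alph y), gI y θ) 0 m := by
  obtain ⟨h0, h1⟩ := hm
  have hx : (fun y => (π - alph y) - (π - alph m)) =O[nhds m] fun y => y - m :=
    ((alph_diff h0).const_sub π).isBigO_sub
  rw [hasDerivAt_iff_isLittleO]
  simp only [intervalIntegral.integral_same, sub_zero, smul_zero]
  refine Asymptotics.IsLittleO.trans_isBigO ?_ hx
  rw [Asymptotics.isLittleO_iff]
  intro c hc
  set M := (m + 1) / 2 with hM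
  have hM1 : M < 1 := by rw [hM]; linarith
  have hmM : m < M := by rw [hM]; linarith
  have hcont : Continuous fun p : ℝ × ℝ => gI (min p.1 M) p.2 :=
    gI_cont (by fun_prop) (by fun_prop) fun p => (min_le_right _ _).trans_lt hM1
  have hz : gI (min m M) (π - alph m) = 0 := by
    rw [min_eq_left hmM.le]
    unfold gI
    rw [Real.sin_pi_sub, sin_alph_sq h0]; simp
  have hev : ∀ᶠ p : ℝ × ℝ in nhds (m, π - alph m), ‖gI (min p.1 M) p.2‖ < c := by
    have := hcont.norm.tendsto (m, π - alph m)
    simp only [hz, norm_zero] at this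
    exact this.eventually (gt_mem_nhds hc)
  rw [Metric.eventually_nhds_iff] at hev
  obtain ⟨ε, hε, hev⟩ := hev
  have hca : ContinuousAt (fun y => π - alph y) m := ((alph_diff h0).const_sub π).continuousAt
  filter_upwards [gt_mem_nhds hmM, Metric.ball_mem_nhds m hε,
    hca.eventually (Metric.ball_mem_nhds _ hε)] with y hy1 hy2 hy3
  rw [Real.norm_eq_abs (π - alph y - _)]
  refine intervalIntegral.norm_integral_le_of_norm_le_const fun θ hθ => ?_
  have hθ' : dist θ (π - alph m) < ε := by
    have := Set.uIoc_subset_uIcc hθ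
    have h4 := Set.abs_sub_left_of_mem_uIcc this
    rw [Real.dist_eq]
    exact h4.trans_lt hy3
  have := @hev (y, θ) (by rw [Prod.dist_eq]; exact max_lt hy2 hθ')
  simp only [min_eq_left hy1.le] at this
  exact this.le

lemma fT_deriv {m : ℝ} (hm : m ∈ Ioo (1 / 2 : ℝ) 1) :
    ∃ d : ℝ, HasDerivAt fT d m ∧ d < 0 := by
  refine ⟨(∫ θ in (0 : ℝ)..(π - alph m), gD m θ) + 0, ?_, ?_⟩
  · refine ((Gw_deriv hm _).add (rest_deriv hm)).congr_of_eventuallyEq ?_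
    filter_upwards [gt_mem_nhds hm.2] with y hy
    exact (intervalIntegral.integral_add_adjacent_intervals (gI_int hy _ _) (gI_int hy _ _)).symm
  · have ha := alph_mem hm.1
    have : 0 < ∫ θ in (0 : ℝ)..(π - alph m), - gD m θ := by
      refine intervalIntegral.intervalIntegral_pos_of_pos_on ?_ ?_ (by linarith [Real.pi_pos])
      · exact (gD_cont continuous_const continuous_id (fun _ => hm.2)).neg.intervalIntegrable _ _
      intro θ hθ
      have hp := den_pos hm.2 θ
      have hs : 0 < Real.sin θ := Real.sin_pos_of_pos_of_lt_pi hθ.1 (by linarith [hθ.2])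
      rw [neg_pos]
      exact div_neg_of_neg_of_pos (mul_neg_of_pos_of_neg (by positivity) (by linarith))
        (mul_pos hp (Real.sqrt_pos.2 hp))
    rw [intervalIntegral.integral_neg] at this
    linarith

lemma fT_cont {M : ℝ} (hM1 : M < 1) : ContinuousOn fT (Icc (1 / 2) M) := by
  have ha : Continuous fun m : ℝ => π - alph (max m (1 / 2)) := by
    unfold alph
    refine continuous_const.sub (Real.continuous_arcsin.comp (Real.continuous_sqrt.comp ?_))
    refine Continuous.div (by fun_prop) (by fun_prop) fun x => ?_
    have : (1 / 2 : ℝ) ≤ max x (1 / 2) := le_max_right _ _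
    linarith
  have hcont : Continuous (Function.uncurry fun m θ : ℝ => gI (min m M) θ) :=
    gI_cont (u := fun p : ℝ × ℝ => min p.1 M) (v := fun p : ℝ × ℝ => p.2) (by fun_prop)
      (by fun_prop) fun p => (min_le_right _ _).trans_lt hM1
  have := intervalIntegral.continuous_parametric_intervalIntegral_of_continuous
    (μ := volume) (a₀ := 0) hcont ha
  refine this.continuousOn.congr fun y hy => ?_
  simp only [min_eq_left hy.2, max_eq_left hy.1]
  rfl

/-- Proposition 2.10 / Appendix B: the function
`f(m) = ∫₀^{π−α(m)} (1 − 2m sin²θ)(1 − m sin²θ)^{−1/2} dθ` has strictly negative derivative on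
`(1/2, 1)`, is positive at `1/2` and negative at `m₈` (the unique zero of `2E − K` in `(0,1)`);
consequently `f` has a unique zero `m_T` in `(0,1)`, and `m_T ∈ (1/2, m₈)`. -/
theorem stmt6 (m8 : ℝ) (hm8 : m8 ∈ Set.Ioo (0:ℝ) 1)
    (hm8zero : 2 * Ec m8 - Kc m8 = 0)
    (hm8uniq : ∀ m ∈ Set.Ioo (0:ℝ) 1, 2 * Ec m - Kc m = 0 → m = m8) :
    (∀ m ∈ Set.Ioo (1/2 : ℝ) 1, ∃ d : ℝ, HasDerivAt fT d m ∧ d < 0) ∧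
    0 < fT (1/2) ∧ fT m8 < 0 ∧
    ∃ mT : ℝ, (mT ∈ Set.Ioo (0:ℝ) 1 ∧ fT mT = 0) ∧
      (∀ m ∈ Set.Ioo (0:ℝ) 1, fT m = 0 → m = mT) ∧
      mT ∈ Set.Ioo (1/2 : ℝ) m8 := by
  have hd : ∀ m ∈ Set.Ioo (1/2 : ℝ) 1, ∃ d : ℝ, HasDerivAt fT d m ∧ d < 0 := fun m hm =>
    fT_deriv hm
  have h8 : 1 / 2 < m8 := by
    by_contra! h
    have := Gw_pos hm8.1 h
    rw [← two_E_sub_K hm8.2] at this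
    linarith
  have hneg : fT m8 < 0 := by
    have := fT_lt h8 hm8.2
    rw [← two_E_sub_K hm8.2] at this
    linarith
  have hpos : 0 < fT (1/2) := fT_half (by norm_num) le_rfl
  have hanti : StrictAntiOn fT (Ioo (1/2 : ℝ) 1) := by
    refine strictAntiOn_of_deriv_neg (convex_Ioo _ _) ?_ ?_
    · intro m hm
      obtain ⟨d, h, _⟩ := hd m hm
      exact h.continuousAt.continuousWithinAt
    · intro m hm
      rw [interior_Ioo] at hm
      obtain ⟨d, h, h'⟩ := hd m hm
      rwa [h.deriv]
  obtain ⟨mT, hmT, hz⟩ := intermediate_value_Ioo' h8.le (fT_cont hm8.2) ⟨hneg, hpos⟩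
  refine ⟨hd, hpos, hneg, mT, ⟨⟨by linarith [hmT.1], hmT.2.trans hm8.2⟩, hz⟩, ?_, hmT⟩
  intro m hm h
  have hm2 : 1 / 2 < m := by
    by_contra! h'
    exact (fT_half hm.1 h').ne' h
  exact hanti.injOn ⟨hm2, hm.2⟩ ⟨hmT.1, hmT.2.trans hm8.2⟩ (h.trans hz.symm)
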